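/- If r is a positive integer divisible by 4, then the Chevalley-Bass number of ℚ(ζ_r) is r; if r is odd, the Chevalley-Bass number of ℚ(ζ_r) is 4r. In particular, ℚ and ℚ(ζ₄) both have Chevalley-Bass number 4. -/

import Mathlib

set_option synthInstance.maxHeartbeats 1000000
noncomputable section

/-- The maximal abelian subextension of `K/ℚ`: the compositum of all subextensions of `K/ℚ`
which are Galois over `ℚ` with abelian Galois group. -/
def maxAb (K : Type*) [Field K] [CharZero K] : IntermediateField ℚ K :=
  ⨆ F ∈ {F : IntermediateField ℚ K |
      IsGalois ℚ ↥F ∧ ∀ σ τ : ↥F ≃ₐ[ℚ] ↥F, σ * τ = τ * σ}, F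

/-- The set of positive integers `Λ` satisfying the Chevalley–Bass property for the field `F`:
for every `n > 0`, `(F(ζ_{Λn})ˣ)^{Λn} ∩ Fˣ ⊆ (Fˣ)ⁿ`, where `F(ζ_{Λn})` is the field obtained
by adjoining all `Λn`-th roots of unity inside the algebraically closed extension `Ω`. -/
def cbSet (F Ω : Type*) [Field F] [Field Ω] [Algebra F Ω] : Set ℕ :=
  {Λ | 0 < Λ ∧ ∀ n : ℕ, 0 < n → ∀ x : F, x ≠ 0 →
    (∃ y ∈ IntermediateField.adjoin F {z : Ω | z ^ (Λ * n) = 1},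
        y ^ (Λ * n) = algebraMap F Ω x) →
    ∃ z : F, z ^ n = x}

/-- The Chevalley–Bass number of a field `F` (computed inside an algebraic closure `Ω`):
the smallest positive integer in `cbSet F Ω`. -/
def chevalleyBass (F Ω : Type*) [Field F] [Field Ω] [Algebra F Ω] : ℕ :=
  sInf (cbSet F Ω)

/-- The number of roots of unity contained in a field `F`. -/
def numRootsOfUnity (F : Type*) [Field F] : ℕ :=
  Nat.card (CommGroup.torsion Fˣ)

/-- The conductor of the maximal abelian subextension of `K/ℚ`: the smallest positive `f`
such that `K_ab ⊆ ℚ(ζ_f)` inside the algebraic closure `Ω`. -/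
def conductorAb (K Ω : Type*) [Field K] [CharZero K] [Field Ω] [Algebra K Ω]
    [Algebra ℚ Ω] [IsScalarTower ℚ K Ω] : ℕ :=
  sInf {f | 0 < f ∧ (maxAb K).map (IsScalarTower.toAlgHom ℚ K Ω)
    ≤ IntermediateField.adjoin ℚ {z : Ω | z ^ f = 1}}

end

theorem Nat.exists_not_dvd_dvd_coprime_one_add {p a m : ℕ} (hp : p.Prime) (hpa : p = 2 → a ≠ 0)
    (hpm : p.Coprime m) :
    ∃ w, ¬ p ∣ w ∧ m ∣ w ∧ p.Coprime (1 + p ^ a * w) := by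
  obtain ⟨w, hw1, hw0⟩ := Nat.chineseRemainder hpm 1 0
  have hpw : ¬ p ∣ w := fun h ↦
    hp.one_lt.ne' (Nat.dvd_one.mp ((hw1.dvd_iff dvd_rfl).mp h))
  refine ⟨w, hpw, (Nat.modEq_zero_iff_dvd).mp hw0, (hp.coprime_iff_not_dvd).mpr fun h ↦ ?_⟩
  rcases Nat.eq_zero_or_pos a with rfl | ha
  · rw [pow_zero, one_mul, ((hw1.add_left 1).dvd_iff dvd_rfl)] at h
    exact hpa ((Nat.prime_dvd_prime_iff_eq hp Nat.prime_two).mp h) rfl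
  · rw [Nat.dvd_add_left ((dvd_pow_self p ha.ne').mul_right w)] at h
    exact hp.one_lt.ne' (Nat.dvd_one.mp h)

theorem emultiplicity_one_add_pow_sub_one {p a w : ℕ} (hp : p.Prime) (ha : a ≠ 0)
    (hpa : p = 2 → 2 ≤ a) (hw : ¬ p ∣ w) (e : ℕ) :
    emultiplicity (p : ℤ) ((1 + p ^ a * w : ℤ) ^ p ^ e - 1) = (a + e : ℕ) := by
  have hpZ : Prime (p : ℤ) := Nat.prime_iff_prime_int.mp hp
  have hdvd : (p : ℤ) ∣ p ^ a * w := (dvd_pow_self _ ha).mul_right _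
  have hndvd : ¬ (p : ℤ) ∣ 1 + p ^ a * w := fun h ↦
    hpZ.not_dvd_one ((dvd_add_left hdvd).mp h)
  have hbase : emultiplicity (p : ℤ) ((1 + p ^ a * w : ℤ) - 1) = a := by
    rw [add_sub_cancel_left, emultiplicity_mul hpZ,
      emultiplicity_pow_self hpZ.ne_zero hpZ.not_isUnit,
      emultiplicity_eq_zero.mpr (mt Int.natCast_dvd_natCast.mp hw), add_zero]
  rcases hp.eq_two_or_odd' with rfl | hodd
  · have h4 : (4 : ℤ) ∣ (1 + (2 : ℕ) ^ a * w : ℤ) - 1 := by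
      rw [add_sub_cancel_left]
      exact ((pow_dvd_pow (2 : ℤ) (hpa rfl)).mul_right _)
    have := Int.two_pow_two_pow_sub_pow_two_pow e h4 hndvd
    rw [one_pow] at this
    push_cast at this hbase ⊢
    rw [this, hbase]
  · have := emultiplicity_pow_prime_pow_sub_pow_prime_pow hpZ hodd
      (x := (1 + p ^ a * w : ℤ)) (y := 1) (by simpa using hdvd) hndvd e
    rw [one_pow] at this
    rw [this, hbase]
    push_cast
    rfl

theorem not_pow_succ_dvd_geom_sum {p a w : ℕ} (hp : p.Prime) (ha : a ≠ 0)
    (hpa : p = 2 → 2 ≤ a) (hw : ¬ p ∣ w) (e : ℕ) :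
    ¬ p ^ (e + 1) ∣ ∑ i ∈ Finset.range (p ^ e), (1 + p ^ a * w) ^ i := by
  intro h
  have h1 : (p : ℤ) ^ (a + e + 1) ∣ (1 + p ^ a * w : ℤ) ^ p ^ e - 1 := by
    rw [← geom_sum_mul, add_sub_cancel_left, add_assoc, add_comm a, pow_add]
    refine mul_dvd_mul ?_ (dvd_mul_right _ _)
    exact_mod_cast h
  have h2 := emultiplicity_one_add_pow_sub_one hp ha hpa hw e
  have := le_emultiplicity_of_pow_dvd h1
  rw [h2] at this
  exact absurd (Nat.cast_le.mp this) (by omega)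

theorem pow_dvd_one_add_pow_sub_one {p a w : ℕ} (hp : p.Prime) (ha : a ≠ 0)
    (hpa : p = 2 → 2 ≤ a) (hw : ¬ p ∣ w) (e : ℕ) :
    (1 + p ^ a * w) ^ p ^ e ≡ 1 [MOD p ^ (a + e)] := by
  refine (Nat.ModEq.symm ?_)
  rw [Nat.modEq_iff_dvd]
  push_cast
  exact pow_dvd_of_le_emultiplicity (emultiplicity_one_add_pow_sub_one hp ha hpa hw e).ge

theorem AlgEquiv.pow_apply_eq_geom_sum {F L : Type*} [Field F] [Field L] [Algebra F L]
    (σ : L ≃ₐ[F] L) {u : ℕ} {c y : L} (hc : σ c = c ^ u) (hy : σ y = c * y) (i : ℕ) :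
    (σ ^ i) y = c ^ (∑ j ∈ Finset.range i, u ^ j) * y := by
  induction i with
  | zero => simp
  | succ i ih =>
    rw [pow_succ', AlgEquiv.mul_apply, ih, map_mul, map_pow, hc, hy, geom_sum_succ, pow_succ,
      pow_mul, mul_assoc]

theorem AlgEquiv.pow_apply_eq_pow_pow {F L : Type*} [Field F] [Field L] [Algebra F L]
    (σ : L ≃ₐ[F] L) {u : ℕ} {c : L} (hc : σ c = c ^ u) (i : ℕ) :
    (σ ^ i) c = c ^ u ^ i := by
  induction i with
  | zero => simp
  | succ i ih => rw [pow_succ', AlgEquiv.mul_apply, ih, map_pow, hc, ← pow_mul, pow_succ']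

/-- If `σ` acts on the roots of unity of order `p ^ (a + e) * m` by `1 + p ^ a * w`, then every
`p ^ (a + e)`-th root of an element of the base field can be multiplied by a root of unity so that
it becomes `σ`-invariant. -/
theorem exists_mul_fixed_of_pow_mem {F L : Type*} [Field F] [Field L] [Algebra F L]
    {p a e m w : ℕ} [NeZero (p ^ (a + e) * m)] [IsCyclotomicExtension {p ^ (a + e) * m} F L]
    (hp : p.Prime) (hpa : p = 2 → 2 ≤ a) (hw : ¬ p ∣ w) (hm : m ∣ w) (hpm : p.Coprime m)
    {σ : L ≃ₐ[F] L} (hσ : ∀ z : L, z ^ (p ^ (a + e) * m) = 1 → σ z = z ^ (1 + p ^ a * w))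
    {x : F} {y : L} (hy0 : y ≠ 0) (hy : y ^ p ^ (a + e) = algebraMap F L x) :
    ∃ η : L, η ^ p ^ (a + e) = 1 ∧ σ (η * y) = η * y := by
  have hp0 := hp.pos
  have hσ' : ∀ z : L, z ^ p ^ (a + e) = 1 → σ z = z ^ (1 + p ^ a * w) := fun z hz ↦
    hσ z (by rw [pow_mul, hz, one_pow])
  obtain ⟨c, hc⟩ : ∃ c, σ y = c * y := ⟨σ y / y, (div_mul_cancel₀ _ hy0).symm⟩
  have hcN : c ^ p ^ (a + e) = 1 := by
    have : (σ y) ^ p ^ (a + e) = y ^ p ^ (a + e) := by rw [← map_pow, hy, AlgEquiv.commutes]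
    rw [hc, mul_pow] at this
    exact (mul_eq_right₀ (pow_ne_zero _ hy0)).mp this
  have hce : c ^ p ^ e = 1 := by
    rcases eq_or_ne a 0 with rfl | ha
    · simpa using hcN
    have hone : σ ^ p ^ e = 1 := by
      refine IsCyclotomicExtension.algEquiv_eq_of_apply_eq {p ^ (a + e) * m} F L
        fun n hn _ ↦ ?_
      rw [Set.mem_singleton_iff] at hn
      subst hn
      have hζ := IsCyclotomicExtension.zeta_spec (p ^ (a + e) * m) F L
      refine ⟨_, hζ, ?_⟩
      rw [AlgEquiv.pow_apply_eq_pow_pow σ (hσ _ hζ.pow_eq_one), AlgEquiv.one_apply]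
      have h1 : (1 + p ^ a * w) ^ p ^ e ≡ 1 [MOD p ^ (a + e) * m] := by
        refine (Nat.modEq_and_modEq_iff_modEq_mul (hpm.pow_left _)).mp
          ⟨pow_dvd_one_add_pow_sub_one hp ha hpa hw e, ?_⟩
        have : 1 + p ^ a * w ≡ 1 + 0 [MOD m] :=
          Nat.ModEq.add_left 1 (Nat.modEq_zero_iff_dvd.mpr (hm.mul_left _))
        simpa using this.pow (p ^ e)
      have := (hζ.isOfFinOrder (NeZero.ne _)).pow_eq_pow_iff_modEq.mpr (hζ.eq_orderOf ▸ h1)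
      simpa using this
    have hS : c ^ (∑ j ∈ Finset.range (p ^ e), (1 + p ^ a * w) ^ j) = 1 := by
      have := AlgEquiv.pow_apply_eq_geom_sum σ (hσ' c hcN) hc (p ^ e)
      rw [hone, AlgEquiv.one_apply] at this
      exact (mul_eq_right₀ hy0).mp this.symm
    obtain ⟨i, -, hi⟩ := (Nat.dvd_prime_pow hp).mp (orderOf_dvd_of_pow_eq_one hcN)
    rw [← orderOf_dvd_iff_pow_eq_one, hi]
    refine pow_dvd_pow p (Nat.le_of_not_lt fun hlt ↦ ?_)
    refine not_pow_succ_dvd_geom_sum hp ha hpa hw e ((pow_dvd_pow p hlt).trans ?_)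
    rw [← hi]
    exact orderOf_dvd_of_pow_eq_one hS
  have hζ : IsPrimitiveRoot (IsCyclotomicExtension.zeta (p ^ (a + e) * m) F L ^ m) (p ^ (a + e)) :=
    (IsCyclotomicExtension.zeta_spec (p ^ (a + e) * m) F L).pow (NeZero.pos _) (mul_comm _ _)
  generalize IsCyclotomicExtension.zeta (p ^ (a + e) * m) F L ^ m = ζ at hζ
  have : NeZero (p ^ (a + e)) := ⟨(pow_pos hp0 _).ne'⟩
  obtain ⟨j, -, hj⟩ := hζ.eq_pow_of_pow_eq_one (ξ := c⁻¹) (by rw [inv_pow, hcN, inv_one])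
  obtain ⟨k, rfl⟩ : p ^ a ∣ j := by
    have : ζ ^ (j * p ^ e) = 1 := by rw [pow_mul, hj, inv_pow, hce, inv_one]
    rw [hζ.pow_eq_one_iff_dvd, pow_add] at this
    exact Nat.dvd_of_mul_dvd_mul_right (pow_pos hp0 _) this
  obtain ⟨v, -, hv⟩ := Nat.exists_mul_mod_eq_of_coprime k
    (((hp.coprime_iff_not_dvd.mpr hw).pow_left (a + e)).symm) (pow_pos hp0 _).ne'
  have hη : (ζ ^ v) ^ p ^ (a + e) = 1 := by rw [pow_right_comm, hζ.pow_eq_one, one_pow]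
  refine ⟨ζ ^ v, hη, ?_⟩
  have hinv : (ζ ^ v) ^ (p ^ a * w) = c⁻¹ := by
    have h1 : p ^ a * (w * v) ≡ p ^ a * k [MOD p ^ (a + e)] := Nat.ModEq.mul_left _ hv
    have := (hζ.isOfFinOrder (NeZero.ne _)).pow_eq_pow_iff_modEq.mpr (hζ.eq_orderOf ▸ h1)
    rw [← hj, ← this, ← pow_mul]
    congr 1
    ring
  have hc0 : c ≠ 0 := by
    rintro rfl
    rw [zero_pow (pow_pos hp0 _).ne'] at hcN
    exact zero_ne_one hcN
  rw [map_mul, hσ' _ hη, hc, pow_add, pow_one, hinv]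
  field_simp

theorem exists_pow_prime_pow_eq {F L : Type*} [Field F] [Field L] [Algebra F L]
    {p a e m w : ℕ} [NeZero (p ^ (a + e) * m)] [IsCyclotomicExtension {p ^ (a + e) * m} F L]
    (hp : p.Prime) (hpa : p = 2 → 2 ≤ a) (hw : ¬ p ∣ w) (hm : m ∣ w) (hpm : p.Coprime m)
    {σ : L ≃ₐ[F] L} (hσ : ∀ z : L, z ^ (p ^ (a + e) * m) = 1 → σ z = z ^ (1 + p ^ a * w))
    {x : F} {y : L} (hy0 : y ≠ 0) (hy : y ^ p ^ (a + e) = algebraMap F L x) :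
    ∃ z : F, z ^ p ^ e = x := by
  obtain ⟨η, hη, hfix⟩ := exists_mul_fixed_of_pow_mem hp hpa hw hm hpm hσ hy0 hy
  have hη0 : η ≠ 0 := by
    rintro rfl
    rw [zero_pow (pow_pos hp.pos _).ne'] at hη
    exact zero_ne_one hη
  have hy' : (η * y) ^ p ^ (a + e) = algebraMap F L x := by rw [mul_pow, hη, one_mul, hy]
  have hy0' : η * y ≠ 0 := mul_ne_zero hη0 hy0
  generalize η * y = t at hfix hy' hy0'
  have := IsCyclotomicExtension.isGalois {p ^ (a + e) * m} F L
  have := IsCyclotomicExtension.finiteDimensional {p ^ (a + e) * m} F L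
  have hcomm := IsCyclotomicExtension.isMulCommutative {p ^ (a + e) * m} F L
  have hmem : t ^ p ^ a ∈ Set.range (algebraMap F L) := by
    rw [IsGalois.mem_range_algebraMap_iff_fixed]
    intro τ
    obtain ⟨d, hd⟩ : ∃ d, τ t = d * t := ⟨τ t / t, (div_mul_cancel₀ _ hy0').symm⟩
    have hdN : d ^ p ^ (a + e) = 1 := by
      have : (τ t) ^ p ^ (a + e) = t ^ p ^ (a + e) := by
        rw [← map_pow, hy', AlgEquiv.commutes]
      rw [hd, mul_pow] at this
      exact (mul_eq_right₀ (pow_ne_zero _ hy0')).mp this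
    have hd0 : d ≠ 0 := by
      rintro rfl
      rw [zero_pow (pow_pos hp.pos _).ne'] at hdN
      exact zero_ne_one hdN
    have hστ : σ (τ t) = τ (σ t) := DFunLike.congr_fun (hcomm.is_comm.comm σ τ) t
    rw [hfix, hd, map_mul, hfix, hσ d (by rw [pow_mul, hdN, one_pow])] at hστ
    have hd1 : d ^ (p ^ a * w) = 1 := by
      have := mul_right_cancel₀ hy0' hστ
      rw [pow_add, pow_one] at this
      exact (mul_eq_left₀ hd0).mp this
    have hda : d ^ p ^ a = 1 := by
      rw [pow_mul] at hd1
      have h2 : (d ^ p ^ a) ^ p ^ e = 1 := by rw [← pow_mul, ← pow_add, hdN]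
      have h3 : orderOf (d ^ p ^ a) ∣ 1 := by
        rw [← Nat.Coprime.gcd_eq_one ((hp.coprime_iff_not_dvd.mpr hw).pow_left e)]
        exact Nat.dvd_gcd (orderOf_dvd_of_pow_eq_one h2) (orderOf_dvd_of_pow_eq_one hd1)
      simpa [Nat.dvd_one] using h3
    rw [map_pow, hd, mul_pow, hda, one_mul]
  obtain ⟨z, hz⟩ := hmem
  refine ⟨z, (algebraMap F L).injective ?_⟩
  rw [map_pow, hz, ← pow_mul, ← pow_add, hy']

theorem exists_pow_eq_of_forall_prime {F : Type*} [Field F] {x : F} (hx : x ≠ 0) {n : ℕ}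
    (hn : n ≠ 0) (h : ∀ p : ℕ, p.Prime → ∃ z : F, z ^ p ^ n.factorization p = x) :
    ∃ z : F, z ^ n = x := by
  induction n using Nat.recOnPosPrimePosCoprime with
  | prime_pow p k hp _ => simpa [hp.factorization_pow] using h p hp
  | zero => exact absurd rfl hn
  | one => exact ⟨x, pow_one x⟩
  | coprime a b ha hb hab iha ihb =>
    have ha0 : a ≠ 0 := by omega
    have hb0 : b ≠ 0 := by omega
    have key : ∀ p : ℕ, p.Prime → ∀ k ≤ (a * b).factorization p, ∃ z : F, z ^ p ^ k = x := by
      intro p hp k hk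
      obtain ⟨z, hz⟩ := h p hp
      refine ⟨z ^ p ^ ((a * b).factorization p - k), ?_⟩
      rw [← pow_mul, ← pow_add, Nat.sub_add_cancel hk, hz]
    have hle := Nat.factorization_mul ha0 hb0
    obtain ⟨s, hs⟩ := iha ha0 fun p hp ↦ key p hp _ (by simp [hle])
    obtain ⟨t, ht⟩ := ihb hb0 fun p hp ↦ key p hp _ (by simp [hle])
    have hs0 : s ≠ 0 := by rintro rfl; exact hx (by rw [← hs, zero_pow ha0])
    have ht0 : t ≠ 0 := by rintro rfl; exact hx (by rw [← ht, zero_pow hb0])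
    have hbez := Nat.gcd_eq_gcd_ab a b
    rw [hab.gcd_eq_one] at hbez
    refine ⟨s ^ a.gcdB b * t ^ a.gcdA b, ?_⟩
    rw [← zpow_natCast, mul_zpow, ← zpow_mul, ← zpow_mul]
    have h1 : s ^ (a.gcdB b * ((a * b : ℕ) : ℤ)) = x ^ (b * a.gcdB b : ℤ) := by
      rw [← hs, ← zpow_natCast, ← zpow_mul]; congr 1; push_cast; ring
    have h2 : t ^ (a.gcdA b * ((a * b : ℕ) : ℤ)) = x ^ (a * a.gcdA b : ℤ) := by
      rw [← ht, ← zpow_natCast, ← zpow_mul]; congr 1; push_cast; ring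
    rw [h1, h2, ← zpow_add₀ hx, add_comm, ← hbez, Nat.cast_one, zpow_one]

theorem isCyclotomicExtension_adjoin_pow_eq_one (F Ω : Type*) [Field F] [Field Ω] [Algebra F Ω]
    [IsAlgClosed Ω] [CharZero Ω] (N : ℕ) [NeZero N] :
    IsCyclotomicExtension {N} F (IntermediateField.adjoin F {z : Ω | z ^ N = 1}) := by
  have := IntermediateField.isCyclotomicExtension_adjoin_of_exists_isPrimitiveRoot {N} F Ω
    fun n hn hn0 ↦ by
      have : NeZero (n : Ω) := ⟨Nat.cast_ne_zero.mpr hn0⟩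
      exact HasEnoughRootsOfUnity.exists_primitiveRoot Ω n
  have hset : {b : Ω | ∃ n ∈ ({N} : Set ℕ), n ≠ 0 ∧ b ^ n = 1} = {z | z ^ N = 1} := by
    ext
    simp [NeZero.ne N]
  rwa [hset] at this

theorem mem_cbSet_of_forall_exists_algEquiv {F Ω : Type*} [Field F] [Field Ω] [Algebra F Ω]
    [IsAlgClosed Ω] [CharZero Ω] {Λ : ℕ} (hΛ : 0 < Λ) (h4 : 4 ∣ Λ)
    (hσ : ∀ N : ℕ, 0 < N → ∀ u : ℕ, u.Coprime N → Λ ∣ N → u ≡ 1 [MOD Λ] →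
      ∃ σ : IntermediateField.adjoin F {z : Ω | z ^ N = 1} ≃ₐ[F]
          IntermediateField.adjoin F {z : Ω | z ^ N = 1},
        ∀ z, z ^ N = 1 → σ z = z ^ u) :
    Λ ∈ cbSet F Ω := by
  refine ⟨hΛ, fun n hn x hx ⟨y, hyL, hy⟩ ↦ exists_pow_eq_of_forall_prime hx hn.ne' fun p hp ↦ ?_⟩
  obtain ⟨a, ha⟩ : ∃ a, a = Λ.factorization p := ⟨_, rfl⟩
  obtain ⟨e, he⟩ : ∃ e, e = n.factorization p := ⟨_, rfl⟩
  obtain ⟨b, hb⟩ : ∃ b, Λ = p ^ a * b := ha ▸ Nat.ordProj_dvd Λ p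
  obtain ⟨c, hc⟩ : ∃ c, n = p ^ e * c := he ▸ Nat.ordProj_dvd n p
  have hpb : p.Coprime b := by
    have := Nat.coprime_ordCompl hp hΛ.ne'
    rwa [← ha, hb, Nat.mul_div_cancel_left _ (pow_pos hp.pos _)] at this
  have hpc : p.Coprime c := by
    have := Nat.coprime_ordCompl hp hn.ne'
    rwa [← he, hc, Nat.mul_div_cancel_left _ (pow_pos hp.pos _)] at this
  have hpbc : p.Coprime (b * c) := hpb.mul_right hpc
  have hpa : p = 2 → 2 ≤ a := by
    rintro rfl
    rw [ha]
    exact (Nat.prime_two.pow_dvd_iff_le_factorization hΛ.ne').mp h4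
  have hN : Λ * n = p ^ (a + e) * (b * c) := by rw [hb, hc, pow_add]; ring
  rw [← he]
  obtain ⟨w, hpw, hmw, hcop⟩ := Nat.exists_not_dvd_dvd_coprime_one_add (a := a) hp
    (fun h h0 ↦ by have := hpa h; omega) hpbc
  have hNpos : 0 < p ^ (a + e) * (b * c) := hN ▸ Nat.mul_pos hΛ hn
  obtain ⟨σ, hσ⟩ := hσ (p ^ (a + e) * (b * c)) hNpos (1 + p ^ a * w)
    (Nat.Coprime.mul_right (hcop.symm.pow_right _) (by
      obtain ⟨k, rfl⟩ := hmw
      rw [show p ^ a * (b * c * k) = b * c * (p ^ a * k) by ring]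
      simp))
    (hN ▸ dvd_mul_right _ _) (by
      have : Λ ∣ p ^ a * w := hb ▸ mul_dvd_mul_left _ ((dvd_mul_right b c).trans hmw)
      simpa using Nat.ModEq.add_left 1 (Nat.modEq_zero_iff_dvd.mpr this))
  rw [hN] at hyL hy
  have : NeZero (p ^ (a + e) * (b * c)) := ⟨hNpos.ne'⟩
  have := isCyclotomicExtension_adjoin_pow_eq_one F Ω (p ^ (a + e) * (b * c))
  have hΩx : algebraMap F Ω x ≠ 0 := (map_ne_zero _).mpr hx
  have hy0 : y ≠ 0 := by
    rintro rfl
    rw [zero_pow hNpos.ne'] at hy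
    exact hΩx hy.symm
  refine exists_pow_prime_pow_eq hp hpa hpw hmw hpbc hσ (y := ⟨y, hyL⟩ ^ (b * c)) ?_ ?_
  · exact pow_ne_zero _ fun h ↦ hy0 congr($h.1)
  · apply Subtype.ext
    rw [← pow_mul, mul_comm (b * c)]
    exact hy

theorem IsCyclotomicExtension.rat_congr {K : Type*} [Field K] {S : Set ℕ} (a b : Algebra ℚ K)
    (h : @IsCyclotomicExtension S ℚ K _ _ a) : @IsCyclotomicExtension S ℚ K _ _ b :=
  Subsingleton.elim a b ▸ h

section Cyclotomic

variable {K L : Type*} [Field K] [Field L] [Algebra ℚ K] [Algebra ℚ L] [Algebra K L]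
  [IsScalarTower ℚ K L] {r N : ℕ} [NeZero r] [NeZero N] [IsCyclotomicExtension {r} ℚ K]

theorem IsCyclotomicExtension.rat_trans_of_dvd [IsCyclotomicExtension {N} K L] (h : r ∣ N) :
    IsCyclotomicExtension {N} ℚ L := by
  have := IsCyclotomicExtension.trans {r} {N} ℚ K L (algebraMap K L).injective
  rw [Set.union_comm] at this
  exact (IsCyclotomicExtension.iff_union_of_dvd (S := {N}) ℚ L ⟨N, rfl, NeZero.ne N, h⟩).mpr this

theorem IsCyclotomicExtension.rat_trans_of_coprime [IsCyclotomicExtension {N} K L]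
    (h : r.Coprime N) : IsCyclotomicExtension {r * N} ℚ L := by
  have htrans := IsCyclotomicExtension.trans {r} {N} ℚ K L (algebraMap K L).injective
  have hprim : IsPrimitiveRoot
      (algebraMap K L (IsCyclotomicExtension.zeta r ℚ K) * IsCyclotomicExtension.zeta N K L)
      (r * N) := by
    have h1 := (IsCyclotomicExtension.zeta_spec r ℚ K).map_of_injective (algebraMap K L).injective
    have h2 := IsCyclotomicExtension.zeta_spec N K L
    rw [IsPrimitiveRoot.iff_orderOf, (Commute.all _ _).orderOf_mul_eq_mul_orderOf_of_coprime,
      ← h1.eq_orderOf, ← h2.eq_orderOf]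
    rwa [← h1.eq_orderOf, ← h2.eq_orderOf]
  have hne : r * N ≠ 0 := NeZero.ne _
  have := IsCyclotomicExtension.union_of_isPrimitiveRoot ({r} ∪ {N}) ℚ L hprim
  rw [show ({r} ∪ {N} ∪ {r * N} : Set ℕ) = {r * N} ∪ {N} ∪ {r} by
    rw [Set.union_comm, Set.union_comm {r}, Set.union_assoc]] at this
  rw [IsCyclotomicExtension.iff_union_of_dvd (n := N) (S := {r * N}) ℚ L ⟨r * N, rfl, hne, dvd_mul_left _ _⟩,
    IsCyclotomicExtension.iff_union_of_dvd (n := r) (S := {r * N} ∪ {N}) ℚ L ⟨r * N, .inl rfl, hne, dvd_mul_right _ _⟩]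
  exact this

theorem IsCyclotomicExtension.exists_algEquiv_pow [IsCyclotomicExtension {N} K L] (h : r ∣ N)
    {u : ℕ} (hu : u.Coprime N) (hur : u ≡ 1 [MOD r]) :
    ∃ σ : L ≃ₐ[K] L, ∀ z, z ^ N = 1 → σ z = z ^ u := by
  have := IsCyclotomicExtension.rat_trans_of_dvd (K := K) (L := L) h
  have hζ := IsCyclotomicExtension.zeta_spec N ℚ L
  obtain ⟨σ, hσ⟩ : ∃ σ : L ≃ₐ[ℚ] L, ∀ z, z ^ N = 1 → σ z = z ^ u := by
    let e := IsCyclotomicExtension.autEquivPow L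
      (Polynomial.cyclotomic.irreducible_rat (NeZero.pos N))
    refine ⟨e.symm (ZMod.unitOfCoprime u hu), fun z hz ↦ ?_⟩
    have hζu : e.symm (ZMod.unitOfCoprime u hu) (IsCyclotomicExtension.zeta N ℚ L) =
        IsCyclotomicExtension.zeta N ℚ L ^ u := by
      have := hζ.autToPow_spec ℚ (e.symm (ZMod.unitOfCoprime u hu))
      rw [← this]
      have h2 : hζ.autToPow ℚ (e.symm (ZMod.unitOfCoprime u hu)) = ZMod.unitOfCoprime u hu :=
        e.apply_symm_apply _
      rw [h2, ZMod.coe_unitOfCoprime, ZMod.val_natCast]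
      refine (hζ.isOfFinOrder (NeZero.ne _)).pow_eq_pow_iff_modEq.mpr ?_
      rw [← hζ.eq_orderOf]
      exact Nat.mod_modEq _ _
    obtain ⟨i, -, rfl⟩ := hζ.eq_pow_of_pow_eq_one hz
    rw [map_pow, hζu, pow_right_comm]
  have hfix : σ.toAlgHom.comp (IsScalarTower.toAlgHom ℚ K L) = IsScalarTower.toAlgHom ℚ K L := by
    have hξ := IsCyclotomicExtension.zeta_spec r ℚ K
    refine (hξ.powerBasis ℚ).algHom_ext ?_
    have hξ' := hξ.map_of_injective (algebraMap K L).injective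
    obtain ⟨k, hk⟩ := h
    have h1 : σ (algebraMap K L (IsCyclotomicExtension.zeta r ℚ K)) =
        algebraMap K L (IsCyclotomicExtension.zeta r ℚ K) := by
      rw [hσ _ (by rw [hk, pow_mul, hξ'.pow_eq_one, one_pow])]
      have := (hξ'.isOfFinOrder (NeZero.ne _)).pow_eq_pow_iff_modEq.mpr (hξ'.eq_orderOf ▸ hur)
      rw [this, pow_one]
    simpa using h1
  exact ⟨AlgEquiv.ofRingEquiv (f := σ.toRingEquiv) fun x ↦ DFunLike.congr_fun hfix x, hσ⟩

theorem IsCyclotomicExtension.finrank_of_coprime [IsCyclotomicExtension {N} K L]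
    (h : r.Coprime N) : Module.finrank K L = N.totient := by
  have := IsCyclotomicExtension.rat_trans_of_coprime (K := K) (L := L) h
  have h1 := IsCyclotomicExtension.finrank K (n := r)
    (Polynomial.cyclotomic.irreducible_rat (NeZero.pos r))
  have h2 := IsCyclotomicExtension.finrank L (n := r * N)
    (Polynomial.cyclotomic.irreducible_rat (NeZero.pos (r * N)))
  rw [← Module.finrank_mul_finrank ℚ K L, h1, Nat.totient_mul h] at h2
  exact Nat.eq_of_mul_eq_mul_left (Nat.totient_pos.mpr (NeZero.pos r)) h2

end Cyclotomic

theorem dvd_of_mem_cbSet {F Ω : Type} [Field F] [Field Ω] [Algebra F Ω] [IsAlgClosed Ω]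
    [CharZero Ω] {m q Λ : ℕ} [NeZero m] (hq : q.Prime) (hmq : m.Coprime q) {ω : F}
    (hω : IsPrimitiveRoot ω m)
    (hdeg : m ∣ Module.finrank F (IntermediateField.adjoin F {z : Ω | z ^ q = 1}))
    (hΛ : Λ ∈ cbSet F Ω) : m ∣ Λ := by
  have : Fact q.Prime := ⟨hq⟩
  have hcyc := isCyclotomicExtension_adjoin_pow_eq_one F Ω q
  obtain ⟨E, hE⟩ : ∃ E, E = IntermediateField.adjoin F {z : Ω | z ^ q = 1} := ⟨_, rfl⟩
  rw [← hE] at hcyc hdeg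
  have := IsCyclotomicExtension.isGalois {q} F E
  have := IsCyclotomicExtension.finiteDimensional {q} F E
  have : IsCyclic (E ≃ₐ[F] E) := isCyclic_of_injective _
    ((IsCyclotomicExtension.zeta_spec q F E).autToPow_injective F)
  obtain ⟨g, hg⟩ := IsCyclic.exists_generator (α := E ≃ₐ[F] E)
  obtain ⟨y, hy⟩ := groupCohomology.exists_div_of_norm_eq_one hg (x := algebraMap F E ω) (by
    rw [Algebra.norm_algebraMap, hω.pow_eq_one_iff_dvd]
    exact hdeg)
  obtain ⟨x, hx⟩ : ((y : E) ^ m) ∈ Set.range (algebraMap F E) := by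
    rw [IsGalois.mem_range_algebraMap_iff_fixed]
    intro τ
    have hgm : g • ((y : E) ^ m) = (y : E) ^ m := by
      have := congr($hy ^ m)
      rw [← map_pow, hω.pow_eq_one, map_one, div_pow, ← map_pow,
        div_eq_one_iff_eq ((map_ne_zero g).mpr (pow_ne_zero _ y.ne_zero))] at this
      exact this.symm
    exact Subgroup.zpowers_le.mpr (MulAction.mem_stabilizer_iff.mpr hgm) (hg τ)
  have hx0 : x ≠ 0 := by
    rintro rfl
    rw [map_zero] at hx
    exact pow_ne_zero m y.ne_zero hx.symm
  obtain ⟨z, hz⟩ := hΛ.2 (m * q) (Nat.mul_pos (NeZero.pos m) hq.pos) (x ^ (Λ * q))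
    (pow_ne_zero _ hx0) ⟨(y : E), by
      refine IntermediateField.adjoin.mono F _ _ ?_ (hE.le (y : E).2)
      intro s hs
      rw [Set.mem_ofPred_eq] at hs ⊢
      rw [show Λ * (m * q) = q * (Λ * m) by ring, pow_mul, hs, one_pow], by
      rw [map_pow, IsScalarTower.algebraMap_apply F E Ω, hx, map_pow, ← pow_mul]
      rw [show m * (Λ * q) = Λ * (m * q) by ring]
      rfl⟩
  have hz0 : z ≠ 0 := by
    rintro rfl
    rw [zero_pow (Nat.mul_pos (NeZero.pos m) hq.pos).ne'] at hz
    exact pow_ne_zero _ hx0 hz.symm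
  have hzE : algebraMap F E z ≠ 0 := (map_ne_zero _).mpr hz0
  have hroot : (((y : E) ^ Λ / algebraMap F E z) ^ q) ^ m = 1 := by
    rw [← pow_mul, div_pow, div_eq_one_iff_eq (pow_ne_zero _ hzE), ← map_pow, mul_comm q, hz,
      map_pow, hx, ← pow_mul, ← pow_mul]
    congr 1
    ring
  obtain ⟨i, -, hi⟩ :=
    (hω.map_of_injective (algebraMap F E).injective).eq_pow_of_pow_eq_one hroot
  have hfix : g ((y : E) ^ (Λ * q)) = (y : E) ^ (Λ * q) := by
    rw [div_pow, eq_div_iff (pow_ne_zero _ hzE), ← pow_mul, ← map_pow, ← map_pow, ← map_mul] at hi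
    rw [← hi, AlgEquiv.commutes]
  have hone : ω ^ (Λ * q) = 1 := by
    apply (algebraMap F E).injective
    rw [map_pow, ← hy, div_pow, ← map_pow, hfix, map_one]
    exact div_self (pow_ne_zero _ y.ne_zero)
  exact hmq.dvd_of_dvd_mul_right ((hω.pow_eq_one_iff_dvd _).mp hone)

theorem four_dvd_of_mem_cbSet {F Ω : Type*} [Field F] [CharZero F] [Field Ω] [Algebra F Ω]
    [IsAlgClosed Ω] (hF : ∀ i : F, i ^ 2 ≠ -1) {Λ : ℕ} (hΛ : Λ ∈ cbSet F Ω) (h2 : 2 ∣ Λ) :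
    4 ∣ Λ := by
  by_contra h4
  obtain ⟨k, rfl⟩ := h2
  have hk : Odd k := by
    rw [← Nat.not_even_iff_odd]
    rintro ⟨j, rfl⟩
    exact h4 ⟨j, by ring⟩
  obtain ⟨I, hI⟩ := IsAlgClosed.exists_pow_nat_eq (-1 : Ω) two_pos
  have hI4 : I ^ 4 = 1 := by linear_combination (I ^ 2 - 1) * hI
  have hexp : 2 * k * 2 = 4 * k := by ring
  obtain ⟨z, hz⟩ := hΛ.2 2 two_pos ((-4) ^ k) (pow_ne_zero _ (by norm_num)) ⟨1 + I,
    add_mem (one_mem _) (IntermediateField.subset_adjoin _ _ (by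
      rw [Set.mem_ofPred_eq, hexp, pow_mul, hI4, one_pow])), by
    rw [hexp, pow_mul, map_pow, map_neg, map_ofNat]
    congr 1
    linear_combination (I ^ 2 + 4 * I + 5) * hI⟩
  refine hF (z / 2 ^ k) ?_
  rw [div_pow, hz, div_eq_iff (pow_ne_zero _ (pow_ne_zero _ two_ne_zero)), hk.neg_pow, ← pow_mul, mul_comm k, pow_mul]
  norm_num

theorem chevalleyBass_eq_of_forall_dvd {F Ω : Type*} [Field F] [Field Ω] [Algebra F Ω] {Λ : ℕ}
    (hΛ : Λ ∈ cbSet F Ω) (h : ∀ Λ' ∈ cbSet F Ω, Λ ∣ Λ') : chevalleyBass F Ω = Λ :=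
  le_antisymm (Nat.sInf_le hΛ)
    (Nat.le_of_dvd (Nat.sInf_mem ⟨Λ, hΛ⟩).1 (h _ (Nat.sInf_mem ⟨Λ, hΛ⟩)))

section RatCyclotomic

variable {K Ω : Type} [Field K] [Field Ω] [Algebra ℚ K] [CharZero Ω] [Algebra K Ω]
  [IsAlgClosed Ω]

theorem mem_cbSet_of_isCyclotomicExtension_rat (r : ℕ) [NeZero r] [IsCyclotomicExtension {r} ℚ K]
    {Λ : ℕ} (hΛ : 0 < Λ) (h4 : 4 ∣ Λ) (hr : r ∣ Λ) : Λ ∈ cbSet K Ω := by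
  refine mem_cbSet_of_forall_exists_algEquiv hΛ h4 fun N hN u hu hΛN hu1 ↦ ?_
  have : NeZero N := ⟨hN.ne'⟩
  have := isCyclotomicExtension_adjoin_pow_eq_one K Ω N
  have : IsScalarTower ℚ K (IntermediateField.adjoin K {z : Ω | z ^ N = 1}) :=
    .of_algebraMap_eq' (Subsingleton.elim _ _)
  exact IsCyclotomicExtension.exists_algEquiv_pow (hr.trans hΛN) hu (hu1.of_dvd hr)

theorem dvd_of_mem_cbSet_of_isCyclotomicExtension_rat (r : ℕ) [NeZero r]
    [IsCyclotomicExtension {r} ℚ K] {m Λ : ℕ} [NeZero m] {ω : K} (hω : IsPrimitiveRoot ω m)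
    (hΛ : Λ ∈ cbSet K Ω) : m ∣ Λ := by
  obtain ⟨q, hq, hlt, hmod⟩ := Nat.exists_prime_gt_modEq_one (m * r) (NeZero.ne m)
  have : NeZero q := ⟨hq.ne_zero⟩
  have hm : m < q := (Nat.le_mul_of_pos_right m (NeZero.pos r)).trans_lt hlt
  have hr : r < q := (Nat.le_mul_of_pos_left r (NeZero.pos m)).trans_lt hlt
  have := isCyclotomicExtension_adjoin_pow_eq_one K Ω q
  have : IsScalarTower ℚ K (IntermediateField.adjoin K {z : Ω | z ^ q = 1}) :=
    .of_algebraMap_eq' (Subsingleton.elim _ _)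
  refine dvd_of_mem_cbSet hq (Nat.coprime_of_lt_prime (NeZero.ne m) hm hq).symm hω ?_ hΛ
  rw [IsCyclotomicExtension.finrank_of_coprime (r := r)
    (Nat.coprime_of_lt_prime (NeZero.ne r) hr hq).symm, Nat.totient_prime hq]
  exact (Nat.modEq_iff_dvd' hq.one_lt.le).mp hmod.symm

theorem chevalleyBass_of_four_dvd (r : ℕ) [NeZero r] [IsCyclotomicExtension {r} ℚ K]
    (h4 : 4 ∣ r) : chevalleyBass K Ω = r :=
  chevalleyBass_eq_of_forall_dvd
    (mem_cbSet_of_isCyclotomicExtension_rat r (NeZero.pos r) h4 dvd_rfl)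
    fun _ hΛ ↦ dvd_of_mem_cbSet_of_isCyclotomicExtension_rat r
      (IsCyclotomicExtension.zeta_spec r ℚ K) hΛ

theorem chevalleyBass_of_odd (r : ℕ) [NeZero r] [IsCyclotomicExtension {r} ℚ K]
    (hr : Odd r) : chevalleyBass K Ω = 4 * r := by
  have : CharZero K := algebraRat.charZero K
  refine chevalleyBass_eq_of_forall_dvd (mem_cbSet_of_isCyclotomicExtension_rat r
    (Nat.mul_pos four_pos (NeZero.pos r)) (dvd_mul_right _ _) (dvd_mul_left _ _)) fun Λ hΛ ↦ ?_
  have : NumberField K := IsCyclotomicExtension.numberField {r} ℚ K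
  have hK : @IsCyclotomicExtension {r} ℚ K _ _ DivisionRing.toRatAlgebra :=
    IsCyclotomicExtension.rat_congr ‹_› _ ‹_›
  refine Nat.Coprime.mul_dvd_of_dvd_of_dvd ?_ (four_dvd_of_mem_cbSet (fun i hi ↦ ?_) hΛ ?_) ?_
  · exact (Nat.coprime_two_left.mpr hr).pow_left 2
  · have hi4 : IsPrimitiveRoot i (2 ^ (1 + 1)) := by
      refine IsPrimitiveRoot.iff_orderOf.mpr (orderOf_eq_prime_pow ?_ ?_)
      · rw [pow_one, hi]
        norm_num
      · rw [pow_succ, pow_one, pow_mul, hi]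
        norm_num
    have := hi4.dvd_of_isCyclotomicExtension r (by norm_num)
    have := hr.not_two_dvd_nat
    omega
  · exact dvd_of_mem_cbSet_of_isCyclotomicExtension_rat r
      (IsPrimitiveRoot.neg_one 0 two_ne_zero.symm) hΛ
  · exact dvd_of_mem_cbSet_of_isCyclotomicExtension_rat r
      (IsCyclotomicExtension.zeta_spec r ℚ K) hΛ

end RatCyclotomic

/-- If `r` is a positive integer divisible by 4, then the Chevalley–Bass number of `ℚ(ζ_r)`
is `r`; if `r` is odd, the Chevalley–Bass number of `ℚ(ζ_r)` is `4r`. In particular, `ℚ` and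
`ℚ(ζ₄)` both have Chevalley–Bass number 4. (Cyclotomic fields are realized inside `ℂ`.) -/
theorem stmt_16 (r : ℕ) (hr : 0 < r) :
    (4 ∣ r →
      chevalleyBass ↥(IntermediateField.adjoin ℚ {z : ℂ | z ^ r = 1}) ℂ = r) ∧
    (Odd r →
      chevalleyBass ↥(IntermediateField.adjoin ℚ {z : ℂ | z ^ r = 1}) ℂ = 4 * r) ∧
    chevalleyBass ℚ ℂ = 4 ∧
    chevalleyBass ↥(IntermediateField.adjoin ℚ {z : ℂ | z ^ 4 = 1}) ℂ = 4 := by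
  have h4 (s : ℕ) (hs : 0 < s) (h : 4 ∣ s) :
      chevalleyBass ↥(IntermediateField.adjoin ℚ {z : ℂ | z ^ s = 1}) ℂ = s := by
    have : NeZero s := ⟨hs.ne'⟩
    have : IsCyclotomicExtension {s} ℚ (IntermediateField.adjoin ℚ {z : ℂ | z ^ s = 1}) :=
      .rat_congr _ _ (isCyclotomicExtension_adjoin_pow_eq_one ℚ ℂ s)
    exact chevalleyBass_of_four_dvd s h
  refine ⟨h4 r hr, fun hodd ↦ ?_, ?_, h4 4 four_pos dvd_rfl⟩
  · have : NeZero r := ⟨hr.ne'⟩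
    have : IsCyclotomicExtension {r} ℚ (IntermediateField.adjoin ℚ {z : ℂ | z ^ r = 1}) :=
      .rat_congr _ _ (isCyclotomicExtension_adjoin_pow_eq_one ℚ ℂ r)
    exact chevalleyBass_of_odd r hodd
  · have : IsCyclotomicExtension {1} ℚ ℚ :=
      IsCyclotomicExtension.singleton_one_of_algebraMap_bijective Function.surjective_id
    simpa using chevalleyBass_of_odd (K := ℚ) (Ω := ℂ) 1 odd_one
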